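/- Let κ > 0 be a killing rate with κ^{−1} > e^{30}, let 0 < ε < 1, let m ≥ 2 be a real number, and set u* := (log m)/(log G^{o,o}). Then for every x ∈ ℤ² with 4 ≤ |x| ≤ 2κ^{−1}, ((G^{o,o})² − (G^{o,x})²)^{−(1−ε)u*} ≤ m^{−(1−ε)} · ((log |x|)/π)^{−(1−ε)u*}. -/

import Mathlib

open scoped Real

/-- Graph (L¹) distance of `x ∈ ℤ²` from the origin: `|x₁| + |x₂|`. -/
def gnorm (x : ℤ × ℤ) : ℕ := x.1.natAbs + x.2.natAbs

/-- `W n x` is the number of nearest-neighbour walks of length `n` in `ℤ²`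
from the origin `o = (0,0)` to `x`, i.e. the number of sequences
`(v₀, …, v_n)` with `v₀ = o`, `v_n = x` and `|v_{i+1} − v_i| = 1` for all `i`. -/
noncomputable def W (n : ℕ) (x : ℤ × ℤ) : ℕ :=
  Set.ncard {v : Fin (n + 1) → ℤ × ℤ |
    v 0 = (0, 0) ∧ v (Fin.last n) = x ∧
    ∀ i : Fin n, gnorm (v i.succ - v i.castSucc) = 1}

/-- The Green's function `G^{o,x}` of the simple random walk on `ℤ²` with
killing rate `κ`: `G κ x = Σ_{n≥0} (4+κ)^{-n} W_n^{o,x}`. -/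
noncomputable def G (κ : ℝ) (x : ℤ × ℤ) : ℝ :=
  ∑' n : ℕ, (1 / (4 + κ)) ^ n * (W n x : ℝ)

/-- The set of walks counted by `W`. -/
def walkSet (n : ℕ) (x : ℤ × ℤ) : Set (Fin (n + 1) → ℤ × ℤ) :=
  {v : Fin (n + 1) → ℤ × ℤ |
    v 0 = (0, 0) ∧ v (Fin.last n) = x ∧
    ∀ i : Fin n, gnorm (v i.succ - v i.castSucc) = 1}

theorem W_eq_walkSet (n : ℕ) (x : ℤ × ℤ) : W n x = (walkSet n x).ncard := rfl

/-- one-dimensional walk counts -/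
def B : ℕ → ℤ → ℕ
  | 0, s => if s = 0 then 1 else 0
  | n + 1, s => B n (s - 1) + B n (s + 1)

theorem gnorm_eq_one (z : ℤ × ℤ) (h : gnorm z = 1) :
    z = (1, 0) ∨ z = (-1, 0) ∨ z = (0, 1) ∨ z = (0, -1) := by
  obtain ⟨a, b⟩ := z
  simp only [gnorm] at h
  simp only [Prod.mk.injEq]
  omega

/-- extension of walks by one final point -/
def ext1 (n : ℕ) (x : ℤ × ℤ) (v : Fin (n + 1) → ℤ × ℤ) : Fin (n + 1 + 1) → ℤ × ℤ :=
  Fin.snoc (α := fun _ => ℤ × ℤ) v x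

theorem ext1_inj (n : ℕ) (x : ℤ × ℤ) : Function.Injective (ext1 n x) := by
  intro v w h
  have := congrArg (Fin.init (α := fun _ => ℤ × ℤ)) h
  simpa [ext1, Fin.init_snoc] using this

theorem ext1_mem (n : ℕ) (x y : ℤ × ℤ) (v : Fin (n + 1) → ℤ × ℤ) (hv : v ∈ walkSet n y)
    (h : gnorm (x - y) = 1) : ext1 n x v ∈ walkSet (n + 1) x := by
  obtain ⟨h0, h1, h2⟩ := hv
  refine ⟨?_, ?_, ?_⟩
  · have : (0 : Fin (n + 1 + 1)) = Fin.castSucc (0 : Fin (n + 1)) := rfl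
    rw [this]
    simp only [ext1, Fin.snoc_castSucc]; exact h0
  · simp [ext1]
  · intro i
    refine Fin.lastCases ?_ (fun j => ?_) i
    · simp only [ext1, Fin.succ_last, Fin.snoc_last, Fin.snoc_castSucc, h1]; exact h
    · rw [← Fin.castSucc_succ]
      simp only [ext1, Fin.snoc_castSucc]; exact h2 j

theorem walkSet_succ (n : ℕ) (x : ℤ × ℤ) :
    walkSet (n + 1) x = ((ext1 n x '' walkSet n (x - (1, 0)) ∪ ext1 n x '' walkSet n (x - (-1, 0)))
      ∪ ext1 n x '' walkSet n (x - (0, 1))) ∪ ext1 n x '' walkSet n (x - (0, -1)) := by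
  ext v
  constructor
  · rintro ⟨h0, h1, h2⟩
    have hv : ext1 n x (Fin.init (α := fun _ => ℤ × ℤ) v) = v := by
      rw [← h1]; exact Fin.snoc_init_self v
    have hl := h2 (Fin.last n)
    rw [Fin.succ_last, h1] at hl
    have hmem : ∀ e, x - v (Fin.last n).castSucc = e →
        Fin.init (α := fun _ => ℤ × ℤ) v ∈ walkSet n (x - e) := by
      rintro e rfl
      refine ⟨h0, ?_, ?_⟩
      · simp [Fin.init]
      · intro i
        have := h2 i.castSucc
        rw [← Fin.castSucc_succ] at this
        exact this
    rcases gnorm_eq_one _ hl with h | h | h | h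
    · exact Or.inl (Or.inl (Or.inl ⟨_, hmem _ h, hv⟩))
    · exact Or.inl (Or.inl (Or.inr ⟨_, hmem _ h, hv⟩))
    · exact Or.inl (Or.inr ⟨_, hmem _ h, hv⟩)
    · exact Or.inr ⟨_, hmem _ h, hv⟩
  · rintro (((⟨w, hw, rfl⟩ | ⟨w, hw, rfl⟩) | ⟨w, hw, rfl⟩) | ⟨w, hw, rfl⟩) <;>
    · refine ext1_mem n x _ w hw ?_
      rw [sub_sub_cancel]; rfl

theorem disj_img (n : ℕ) (x y z : ℤ × ℤ) (h : y ≠ z) :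
    Disjoint (ext1 n x '' walkSet n y) (ext1 n x '' walkSet n z) := by
  rw [Set.disjoint_left]
  rintro _ ⟨v, hv, rfl⟩ ⟨w, hw, hvw⟩
  have := ext1_inj n x hvw
  subst this
  exact h (hv.2.1.symm.trans hw.2.1)

theorem walk_main (n : ℕ) : ∀ x : ℤ × ℤ, (walkSet n x).Finite ∧
    (walkSet n x).ncard = B n (x.1 + x.2) * B n (x.1 - x.2) := by
  induction n with
  | zero =>
    intro x
    by_cases hx : x = (0, 0)
    · have : walkSet 0 x = {fun _ => (0, 0)} := by
        ext v
        constructor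
        · rintro ⟨h, -, -⟩
          funext i
          have hi : i = 0 := Fin.fin_one_eq_zero i
          rw [hi]; exact h
        · rintro rfl
          exact ⟨rfl, hx.symm, fun i => i.elim0⟩
      rw [this]
      subst hx
      simp [B]
    · have : walkSet 0 x = ∅ := by
        ext v
        simp only [Set.mem_empty_iff_false, iff_false]
        rintro ⟨h, h', -⟩
        exact hx (h'.symm.trans h)
      rw [this]
      refine ⟨Set.finite_empty, ?_⟩
      rw [Set.ncard_empty]
      obtain ⟨a, b⟩ := x
      simp only [Prod.mk.injEq] at hx
      simp only [B]
      split_ifs <;> first | omega | simp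
  | succ n ih =>
    intro x
    rw [walkSet_succ]
    have f1 := (ih (x - (1, 0))).1.image (ext1 n x)
    have f2 := (ih (x - (-1, 0))).1.image (ext1 n x)
    have f3 := (ih (x - (0, 1))).1.image (ext1 n x)
    have f4 := (ih (x - (0, -1))).1.image (ext1 n x)
    have hne : ∀ e e' : ℤ × ℤ, e ≠ e' → x - e ≠ x - e' := by
      intro e e' h h'
      exact h (sub_right_injective h')
    refine ⟨((f1.union f2).union f3).union f4, ?_⟩
    rw [Set.ncard_union_eq _ ((f1.union f2).union f3) f4,
      Set.ncard_union_eq _ (f1.union f2) f3, Set.ncard_union_eq _ f1 f2,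
      Set.ncard_image_of_injective _ (ext1_inj n x), Set.ncard_image_of_injective _ (ext1_inj n x),
      Set.ncard_image_of_injective _ (ext1_inj n x), Set.ncard_image_of_injective _ (ext1_inj n x),
      (ih _).2, (ih _).2, (ih _).2, (ih _).2]
    · obtain ⟨a, b⟩ := x
      simp only [Prod.mk_sub_mk, B]
      have e1 : a - 1 + (b - 0) = a + b - 1 := by ring
      have e2 : a - 1 - (b - 0) = a - b - 1 := by ring
      have e3 : a - -1 + (b - 0) = a + b + 1 := by ring
      have e4 : a - -1 - (b - 0) = a - b + 1 := by ring
      have e5 : a - 0 + (b - 1) = a + b - 1 := by ring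
      have e6 : a - 0 - (b - 1) = a - b + 1 := by ring
      have e7 : a - 0 + (b - -1) = a + b + 1 := by ring
      have e8 : a - 0 - (b - -1) = a - b - 1 := by ring
      rw [e1, e2, e3, e4, e5, e6, e7, e8]
      ring
    · exact disj_img _ _ _ _ (hne _ _ (by decide))
    · exact Set.disjoint_union_left.2 ⟨disj_img _ _ _ _ (hne _ _ (by decide)),
        disj_img _ _ _ _ (hne _ _ (by decide))⟩
    · exact Set.disjoint_union_left.2 ⟨Set.disjoint_union_left.2
        ⟨disj_img _ _ _ _ (hne _ _ (by decide)), disj_img _ _ _ _ (hne _ _ (by decide))⟩,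
        disj_img _ _ _ _ (hne _ _ (by decide))⟩

theorem W_eq (n : ℕ) (x : ℤ × ℤ) : W n x = B n (x.1 + x.2) * B n (x.1 - x.2) :=
  (walk_main n x).2

theorem W_succ (n : ℕ) (x : ℤ × ℤ) : W (n + 1) x =
    W n (x - (1, 0)) + W n (x - (-1, 0)) + W n (x - (0, 1)) + W n (x - (0, -1)) := by
  obtain ⟨a, b⟩ := x
  simp only [W_eq, Prod.mk_sub_mk, B]
  have e1 : a - 1 + (b - 0) = a + b - 1 := by ring
  have e2 : a - 1 - (b - 0) = a - b - 1 := by ring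
  have e3 : a - -1 + (b - 0) = a + b + 1 := by ring
  have e4 : a - -1 - (b - 0) = a - b + 1 := by ring
  have e5 : a - 0 + (b - 1) = a + b - 1 := by ring
  have e6 : a - 0 - (b - 1) = a - b + 1 := by ring
  have e7 : a - 0 + (b - -1) = a + b + 1 := by ring
  have e8 : a - 0 - (b - -1) = a - b - 1 := by ring
  rw [e1, e2, e3, e4, e5, e6, e7, e8]
  ring

theorem B_le (n : ℕ) : ∀ s, B n s ≤ 2 ^ n := by
  induction n with
  | zero => intro s; simp only [B]; split_ifs <;> simp
  | succ n ih => intro s; simp only [B, pow_succ]; linarith [ih (s - 1), ih (s + 1)]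

theorem B_zero (n : ℕ) : ∀ s : ℤ, n < s.natAbs → B n s = 0 := by
  induction n with
  | zero => intro s hs; simp only [B]; rw [if_neg]; omega
  | succ n ih => intro s hs; simp only [B]; rw [ih _ (by omega), ih _ (by omega)]

theorem B_odd (n : ℕ) : ∀ s : ℤ, (n + s) % 2 = 1 → B n s = 0 := by
  induction n with
  | zero => intro s hs; simp only [B]; rw [if_neg]; rintro rfl; simp at hs
  | succ n ih =>
    intro s hs; simp only [B]; push_cast at hs
    rw [ih _ (by omega), ih _ (by omega)]

theorem B_choose (n : ℕ) : ∀ j : ℕ, B n (2 * j - n) = n.choose j := by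
  induction n with
  | zero =>
    intro j
    cases j with
    | zero => simp [B]
    | succ j => simp only [B]; rw [if_neg (by push_cast; omega)]; rfl
  | succ n ih =>
    intro j
    simp only [B]
    cases j with
    | zero =>
      rw [B_zero n _ (by push_cast; omega)]
      have := ih 0
      rw [show (2 * ((0 : ℕ) : ℤ) - ((n + 1 : ℕ) : ℤ) + 1) = 2 * ((0 : ℕ) : ℤ) - n by push_cast; ring,
        this]
      simp
    | succ j =>
      rw [show (2 * ((j + 1 : ℕ) : ℤ) - ((n + 1 : ℕ) : ℤ) + 1) = 2 * ((j + 1 : ℕ) : ℤ) - n by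
          push_cast; ring,
        show (2 * ((j + 1 : ℕ) : ℤ) - ((n + 1 : ℕ) : ℤ) - 1) = 2 * ((j : ℕ) : ℤ) - n by
          push_cast; ring, ih, ih, Nat.choose_succ_succ]

theorem B_center (n : ℕ) : B (2 * n) 0 = n.centralBinom := by
  have := B_choose (2 * n) n
  rw [show (2 * (n : ℤ) - ((2 * n : ℕ) : ℤ)) = 0 by push_cast; ring] at this
  rw [this, Nat.centralBinom]

theorem B_le_center (n : ℕ) (s : ℤ) : B (2 * n) s ≤ B (2 * n) 0 := by
  rw [B_center]
  by_cases h : 2 * n < s.natAbs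
  · rw [B_zero _ _ h]; exact Nat.zero_le _
  by_cases h2 : (((2 * n : ℕ) : ℤ) + s) % 2 = 1
  · rw [B_odd _ _ h2]; exact Nat.zero_le _
  obtain ⟨j, hj⟩ : ∃ j : ℕ, s = 2 * (j : ℤ) - ((2 * n : ℕ) : ℤ) :=
    ⟨(((2 * n : ℕ) + s) / 2).toNat, by omega⟩
  rw [hj, B_choose]
  exact Nat.choose_le_centralBinom j n

theorem W_le_center (n : ℕ) (y : ℤ × ℤ) (hy : (y.1 + y.2) % 2 = 0) : W n y ≤ W n (0, 0) := by
  obtain ⟨k, hk | hk⟩ := Nat.even_or_odd' n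
  · subst hk
    rw [W_eq, W_eq]
    exact Nat.mul_le_mul (B_le_center k _) (B_le_center k _)
  · rw [W_eq n y, B_odd n (y.1 + y.2) (by omega)]; simp

theorem W_zero (n : ℕ) (y : ℤ × ℤ) (hy : n < gnorm y) : W n y = 0 := by
  rw [W_eq]
  simp only [gnorm] at hy
  have : n < (y.1 + y.2).natAbs ∨ n < (y.1 - y.2).natAbs := by omega
  rcases this with h | h
  · rw [B_zero _ _ h]; simp
  · rw [B_zero _ _ h]; simp

theorem W_le (n : ℕ) (y : ℤ × ℤ) : W n y ≤ 4 ^ n := by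
  rw [W_eq, show 4 = 2 * 2 by rfl, mul_pow]
  exact Nat.mul_le_mul (B_le _ _) (B_le _ _)

theorem W_center (n : ℕ) : W (2 * n) (0, 0) = n.centralBinom ^ 2 := by
  rw [W_eq]
  have := B_center n
  simp only [add_zero, sub_zero, this, sq]

theorem G_summable (κ : ℝ) (hκ : 0 < κ) (y : ℤ × ℤ) :
    Summable (fun n : ℕ => (1 / (4 + κ)) ^ n * (W n y : ℝ)) := by
  have h4 : 0 < 4 + κ := by linarith
  refine Summable.of_nonneg_of_le (fun n => by positivity) (fun n => ?_)
    (summable_geometric_of_lt_one (r := 4 / (4 + κ)) (by positivity)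
      (by rw [div_lt_one h4]; linarith))
  rw [show 4 / (4 + κ) = 1 / (4 + κ) * 4 by ring, mul_pow]
  have : (W n y : ℝ) ≤ 4 ^ n := by exact_mod_cast W_le n y
  gcongr

theorem G_nonneg (κ : ℝ) (hκ : 0 < κ) (y : ℤ × ℤ) : 0 ≤ G κ y :=
  tsum_nonneg (fun n => by positivity)

/-- partial sum of the Green's function -/
noncomputable def A (κ : ℝ) (r : ℕ) : ℝ :=
  ∑ n ∈ Finset.range r, (1 / (4 + κ)) ^ (2 * n) * ((n.centralBinom : ℝ)) ^ 2

theorem A_le_sum (κ : ℝ) (hκ : 0 < κ) (r : ℕ) :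
    A κ r ≤ ∑ n ∈ Finset.range (2 * r), (1 / (4 + κ)) ^ n * (W n (0, 0) : ℝ) := by
  induction r with
  | zero => simp [A]
  | succ r ih =>
    rw [show 2 * (r + 1) = 2 * r + 1 + 1 by ring, Finset.sum_range_succ, Finset.sum_range_succ]
    unfold A at ih ⊢
    rw [Finset.sum_range_succ, W_center]
    have : 0 ≤ (1 / (4 + κ)) ^ (2 * r + 1) * (W (2 * r + 1) (0, 0) : ℝ) := by positivity
    push_cast
    linarith

theorem G_even (κ : ℝ) (hκ : 0 < κ) (r : ℕ) (y : ℤ × ℤ) (hy : (y.1 + y.2) % 2 = 0)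
    (hr : 2 * r ≤ gnorm y) : G κ y ≤ G κ (0, 0) - A κ r := by
  have h1 := (G_summable κ hκ y).sum_add_tsum_nat_add (2 * r)
  have h2 := (G_summable κ hκ (0, 0)).sum_add_tsum_nat_add (2 * r)
  have h3 : ∑ n ∈ Finset.range (2 * r), (1 / (4 + κ)) ^ n * (W n y : ℝ) = 0 := by
    refine Finset.sum_eq_zero fun n hn => ?_
    rw [W_zero n y (by have := Finset.mem_range.1 hn; omega)]; simp
  have h4 : ∑' n : ℕ, (1 / (4 + κ)) ^ (n + 2 * r) * (W (n + 2 * r) y : ℝ) ≤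
      ∑' n : ℕ, (1 / (4 + κ)) ^ (n + 2 * r) * (W (n + 2 * r) (0, 0) : ℝ) := by
    have s1 : ∀ z, Summable (fun n : ℕ => (1 / (4 + κ)) ^ (n + 2 * r) * (W (n + 2 * r) z : ℝ)) :=
      fun z => (summable_nat_add_iff (f := fun n : ℕ => (1 / (4 + κ)) ^ n * (W n z : ℝ))
        (2 * r)).2 (G_summable κ hκ z)
    refine Summable.tsum_le_tsum (fun n => ?_) (s1 y) (s1 (0, 0))
    have hW : (W (n + 2 * r) y : ℝ) ≤ (W (n + 2 * r) (0, 0) : ℝ) :=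
      Nat.cast_le.2 (W_le_center _ y hy)
    exact mul_le_mul_of_nonneg_left hW (by positivity)
  have h5 := A_le_sum κ hκ r
  unfold G
  linarith

theorem G_rec (κ : ℝ) (hκ : 0 < κ) (x : ℤ × ℤ) (hx : 0 < gnorm x) :
    G κ x = 1 / (4 + κ) * (G κ (x - (1, 0)) + G κ (x - (-1, 0)) + G κ (x - (0, 1))
      + G κ (x - (0, -1))) := by
  have hs := G_summable κ hκ
  unfold G
  rw [(hs x).tsum_eq_zero_add, W_zero 0 x hx,
    ← (hs _).tsum_add (hs _), ← ((hs _).add (hs _)).tsum_add (hs _),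
    ← (((hs _).add (hs _)).add (hs _)).tsum_add (hs _), ← tsum_mul_left]
  simp only [Nat.cast_zero, mul_zero, zero_add]
  congr 1
  funext n
  rw [W_succ]
  push_cast
  ring

theorem G_bound (κ : ℝ) (hκ : 0 < κ) (r : ℕ) (hr1 : 1 ≤ r) (x : ℤ × ℤ)
    (h1 : gnorm x = 2 * r ∨ gnorm x = 2 * r + 1) : G κ x ≤ G κ (0, 0) - A κ r := by
  rcases h1 with h | h
  · refine G_even κ hκ r x ?_ h.ge
    simp only [gnorm] at h; omega
  · have key : ∀ e : ℤ × ℤ, gnorm e = 1 → G κ (x - e) ≤ G κ (0, 0) - A κ r := by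
      intro e he
      obtain ⟨a, b⟩ := x
      obtain ⟨c, d⟩ := e
      simp only [gnorm] at h he
      refine G_even κ hκ r _ ?_ ?_
      · simp only [Prod.mk_sub_mk]; omega
      · simp only [gnorm, Prod.mk_sub_mk]; omega
    rw [G_rec κ hκ x (by omega)]
    have k1 := key (1, 0) rfl
    have k2 := key (-1, 0) rfl
    have k3 := key (0, 1) rfl
    have k4 := key (0, -1) rfl
    have k0 := (G_nonneg κ hκ _).trans k1
    rw [one_div, inv_mul_le_iff₀ (by linarith)]
    nlinarith

theorem central_bound (n : ℕ) : (16 : ℝ) ^ n * (1 / ((n + 1 / 2) * π)) ≤ (n.centralBinom : ℝ) ^ 2 := by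
  have h := Real.Wallis.W_le n
  rw [Real.Wallis.W_eq_factorial_ratio] at h
  have hc : (n.centralBinom : ℝ) * (n.factorial : ℝ) * n.factorial = (2 * n).factorial := by
    have := Nat.choose_mul_factorial_mul_factorial (n := 2 * n) (k := n) (by omega)
    rw [show 2 * n - n = n by omega] at this
    rw [Nat.centralBinom]
    exact_mod_cast this
  rw [← hc] at h
  have hf : (0 : ℝ) < n.factorial := by positivity
  have hb : (0 : ℝ) < n.centralBinom := by exact_mod_cast Nat.centralBinom_pos n
  have hp := Real.pi_pos
  rw [div_le_div_iff₀ (by positivity) (by norm_num)] at h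
  rw [mul_one_div, div_le_iff₀ (by positivity)]
  rw [show (2 : ℝ) ^ (4 * n) = 16 ^ n by rw [pow_mul]; norm_num] at h
  have hf4 : (0 : ℝ) < (n.factorial : ℝ) ^ 4 := by positivity
  refine le_of_mul_le_mul_right ?_ hf4
  nlinarith

theorem harm (r : ℕ) : Real.log (2 * (r + 1 : ℕ) + 1) + 2 - Real.log 3 ≤
    ∑ n ∈ Finset.range (r + 1), 1 / ((n : ℝ) + 1 / 2) := by
  induction r with
  | zero => norm_num
  | succ r ih =>
    rw [Finset.sum_range_succ]
    have hpos : (0 : ℝ) < 2 * (r + 1 : ℕ) + 1 := by positivity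
    have hpos2 : (0 : ℝ) < 2 * (r + 1 + 1 : ℕ) + 1 := by positivity
    have := Real.log_le_sub_one_of_pos (div_pos hpos2 hpos)
    rw [Real.log_div hpos2.ne' hpos.ne'] at this
    have e : (2 * ((r + 1 + 1 : ℕ) : ℝ) + 1) / (2 * ((r + 1 : ℕ) : ℝ) + 1) - 1
        = 1 / (((r + 1 : ℕ) : ℝ) + 1 / 2) := by
      push_cast
      field_simp
      ring
    linarith

theorem A_bound (κ : ℝ) (hκ : 0 < κ) (hκ1 : κ < 1) (r : ℕ) (hr1 : 1 ≤ r) (hr : (r : ℝ) * κ ≤ 1) :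
    Real.log (2 * r + 1) / π ≤ A κ r := by
  have hp := Real.pi_pos
  have hterm : ∀ n ∈ Finset.range r, (1 / π) * (1 / ((n : ℝ) + 1 / 2) - κ / 2) ≤
      (1 / (4 + κ)) ^ (2 * n) * ((n.centralBinom : ℝ)) ^ 2 := by
    intro n hn
    have hn' : (n : ℝ) ≤ r := by exact_mod_cast (Finset.mem_range.1 hn).le
    have hc := central_bound n
    have h1 : (1 - n * κ / 2) ≤ (4 / (4 + κ)) ^ (2 * n) := by
      have b : 1 + ((2 * n : ℕ) : ℝ) * (-κ / 4) ≤ (1 + (-κ / 4)) ^ (2 * n) :=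
        one_add_mul_le_pow (by linarith) _
      have c : (1 + (-κ / 4)) ^ (2 * n) ≤ (4 / (4 + κ)) ^ (2 * n) := by
        refine pow_le_pow_left₀ (by linarith) ?_ _
        rw [le_div_iff₀ (by linarith)]
        nlinarith
      push_cast at b
      linarith
    calc (1 / π) * (1 / ((n : ℝ) + 1 / 2) - κ / 2)
        ≤ (1 - n * κ / 2) * (1 / ((n + 1 / 2) * π)) := by
          rw [show (1 - n * κ / 2) * (1 / (((n : ℝ) + 1 / 2) * π))
            = (1 / π) * ((1 - n * κ / 2) / ((n : ℝ) + 1 / 2)) by field_simp]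
          refine mul_le_mul_of_nonneg_left ?_ (by positivity)
          rw [le_div_iff₀ (by positivity), sub_mul, one_div_mul_cancel (by positivity)]
          nlinarith
      _ ≤ (4 / (4 + κ)) ^ (2 * n) * (1 / ((n + 1 / 2) * π)) := by gcongr
      _ = (1 / (4 + κ)) ^ (2 * n) * (16 ^ n * (1 / ((n + 1 / 2) * π))) := by
          rw [show 4 / (4 + κ) = 1 / (4 + κ) * 4 by ring, mul_pow, pow_mul 4 2 n]
          norm_num
          ring
      _ ≤ _ := by gcongr
  have hsum := Finset.sum_le_sum hterm
  rw [← Finset.mul_sum, Finset.sum_sub_distrib, Finset.sum_const, Finset.card_range,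
    nsmul_eq_mul] at hsum
  obtain ⟨s, rfl⟩ : ∃ s, r = s + 1 := ⟨r - 1, by omega⟩
  have hh := harm s
  have h3 : Real.log 3 ≤ 3 / 2 := by
    rw [Real.log_le_iff_le_exp (by norm_num)]
    have := Real.quadratic_le_exp_of_nonneg (x := 3 / 2) (by norm_num)
    linarith
  unfold A
  refine le_trans ?_ hsum
  rw [div_eq_mul_one_div, mul_comm]
  refine mul_le_mul_of_nonneg_left ?_ (by positivity)
  linarith

theorem G_gt_one (κ : ℝ) (hκ : 0 < κ) : 1 < G κ (0, 0) := by
  have h := G_even κ hκ 2 (2, 2) (by norm_num) (by decide)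
  have h0 := G_nonneg κ hκ (2, 2)
  have : A κ 2 = 1 + (1 / (4 + κ)) ^ 2 * 4 := by
    simp [A, Finset.sum_range_succ, Nat.centralBinom, Nat.choose]
    norm_num
  have h4 : 0 < (1 / (4 + κ)) ^ 2 * 4 := by positivity
  linarith

/-- Proposition 4.1, eq. (4.4): for `κ⁻¹ > e^{30}`, `0 < ε < 1`, `m ≥ 2`,
`u* = log m / log G^{o,o}` and every `4 ≤ |x| ≤ 2κ⁻¹`,
`((G^{o,o})² − (G^{o,x})²)^{−(1−ε)u*} ≤ m^{−(1−ε)} ((log |x|)/π)^{−(1−ε)u*}`. -/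
theorem stmt14 (κ : ℝ) (hκ : 0 < κ) (hκ' : Real.exp 30 < κ⁻¹)
    (ε : ℝ) (hε : 0 < ε) (hε' : ε < 1) (m : ℝ) (hm : 2 ≤ m)
    (x : ℤ × ℤ) (hx : 4 ≤ gnorm x) (hx' : (gnorm x : ℝ) ≤ 2 * κ⁻¹) :
    ((G κ (0, 0)) ^ 2 - (G κ x) ^ 2)
        ^ (-(1 - ε) * (Real.log m / Real.log (G κ (0, 0))))
      ≤ m ^ (-(1 - ε)) *
        (Real.log (gnorm x) / π)
          ^ (-(1 - ε) * (Real.log m / Real.log (G κ (0, 0)))) := by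
  have hκ1 : κ < 1 := by
    have : 1 < κ⁻¹ := lt_trans (Real.one_lt_exp_iff.2 (by norm_num)) hκ'
    exact (one_lt_inv₀ hκ).1 this
  obtain ⟨r, hr⟩ : ∃ r, gnorm x = 2 * r ∨ gnorm x = 2 * r + 1 := ⟨gnorm x / 2, by omega⟩
  have hr1 : 1 ≤ r := by omega
  have hb := G_bound κ hκ r hr1 x hr
  have hrx : (2 * r : ℝ) ≤ gnorm x := by
    have : 2 * r ≤ gnorm x := by omega
    exact_mod_cast this
  have hxr : (gnorm x : ℝ) ≤ 2 * r + 1 := by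
    have : gnorm x ≤ 2 * r + 1 := by omega
    exact_mod_cast this
  have hrκ : (r : ℝ) * κ ≤ 1 := by
    have : (r : ℝ) ≤ κ⁻¹ := by linarith
    calc (r : ℝ) * κ ≤ κ⁻¹ * κ := by gcongr
      _ = 1 := inv_mul_cancel₀ hκ.ne'
  have hA := A_bound κ hκ hκ1 r hr1 hrκ
  have hg := G_gt_one κ hκ
  have hh := G_nonneg κ hκ x
  have hx4 : (4 : ℝ) ≤ gnorm x := by exact_mod_cast hx
  have hL : 0 < Real.log (gnorm x) / π := div_pos (Real.log_pos (by linarith)) Real.pi_pos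
  have hLA : Real.log (gnorm x) / π ≤ Real.log (2 * r + 1) / π := by
    have := Real.pi_pos
    have := Real.log_le_log (by linarith) hxr
    gcongr
  set g := G κ (0, 0)
  set h := G κ x
  set L := Real.log (gnorm x) / π
  have hgh : L ≤ g - h := by linarith
  have hmain : g * L ≤ g ^ 2 - h ^ 2 := by nlinarith
  have hlg : 0 < Real.log g := Real.log_pos hg
  have hlm : 0 < Real.log m := Real.log_pos (by linarith)
  have hexp : -(1 - ε) * (Real.log m / Real.log g) ≤ 0 := by
    have : 0 ≤ (1 - ε) * (Real.log m / Real.log g) :=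
      mul_nonneg (by linarith) (div_pos hlm hlg).le
    linarith
  have hg0 : 0 < g := by linarith
  refine (Real.rpow_le_rpow_of_nonpos (by positivity) hmain hexp).trans (le_of_eq ?_)
  rw [Real.mul_rpow hg0.le hL.le]
  congr 1
  rw [Real.rpow_def_of_pos hg0, Real.rpow_def_of_pos (by linarith)]
  congr 1
  field_simp
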